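/- arXiv:2206.11940 — 6 statements merged into one kernel-verified Lean document; each statement's English description precedes it below -/
import Mathlib

section
/- For every state s ∉ Abs and every terminating trajectory τ from s with achieved goal g, the return of τ under the goal-oriented reward R̄(·, g, ·, ·) equals the return of τ under R (no hypotheses on r̄MIN are needed: since the only absorbing transition of τ is its last one and it is taken from g, the penalty is never triggered). -/
open Classical

/-- The state reached after `i` steps when starting in `s` and executing the actions in `as`
(deterministic transition function `T`). `stateAt T s as 0 = s` and
`stateAt T s as (i+1) = T (stateAt T s as i) (as[i])`. -/
def stateAt {S A : Type*} (T : S → A → S) (s : S) (as : List A) (i : ℕ) : S :=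
  (as.take i).foldl T s

/-- `as` is a terminating trajectory from `s`: it is nonempty, the final induced state is
absorbing, and no earlier induced state is absorbing. -/
def Terminating {S A : Type*} (T : S → A → S) (Abs : Set S) (s : S) (as : List A) : Prop :=
  as ≠ [] ∧ stateAt T s as as.length ∈ Abs ∧ ∀ i < as.length, stateAt T s as i ∉ Abs

/-- The achieved goal of a trajectory: the state from which the terminal transition is taken. -/
def achievedGoal {S A : Type*} (T : S → A → S) (s : S) (as : List A) : S :=
  stateAt T s as (as.length - 1)

/-- The return of a trajectory under reward function `R`: the sum of the one-step rewards. -/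
def ret {S A : Type*} (T : S → A → S) (R : S → A → S → ℝ) : S → List A → ℝ
  | _, [] => 0
  | s, a :: as => R s a (T s a) + ret T R (T s a) as

/-- The internal goal set: all states from which some action leads to an absorbing state. -/
def goalSet {S A : Type*} (T : S → A → S) (Abs : Set S) : Set S :=
  {s | ∃ a : A, T s a ∈ Abs}

/-- The goal-oriented reward: a penalty `rbMIN` for terminal transitions taken from a state
other than the goal `g`, and the task reward `R` otherwise. -/
noncomputable def Rbar {S A : Type*} (Abs : Set S) (rbMIN : ℝ) (R : S → A → S → ℝ) (g : S) :
    S → A → S → ℝ :=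
  fun s a s' => if s ≠ g ∧ s' ∈ Abs then rbMIN else R s a s'

/-- The optimal value `Q*(s, a)`: the supremum of returns under `R` over terminating
trajectories from `s` whose first action is `a`. -/
noncomputable def Qstar {S A : Type*} (T : S → A → S) (Abs : Set S) (R : S → A → S → ℝ)
    (s : S) (a : A) : ℝ :=
  sSup {x | ∃ as : List A, Terminating T Abs s as ∧ as.head? = some a ∧ ret T R s as = x}

/-- The optimal state value `V*(s) = sup_a Q*(s, a)`. -/
noncomputable def Vstar {S A : Type*} (T : S → A → S) (Abs : Set S) (R : S → A → S → ℝ)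
    (s : S) : ℝ :=
  sSup (Set.range (Qstar T Abs R s))

/-- The optimal world value `Q̄*(s, g, a)`: the optimal value for the goal-oriented reward. -/
noncomputable def Qbar {S A : Type*} (T : S → A → S) (Abs : Set S) (rbMIN : ℝ)
    (R : S → A → S → ℝ) (s g : S) (a : A) : ℝ :=
  Qstar T Abs (Rbar Abs rbMIN R g) s a

/-- The optimal world state value `V̄*(s, g) = sup_a Q̄*(s, g, a)`. -/
noncomputable def Vbar {S A : Type*} (T : S → A → S) (Abs : Set S) (rbMIN : ℝ)
    (R : S → A → S → ℝ) (s g : S) : ℝ :=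
  sSup (Set.range (Qbar T Abs rbMIN R s g))

/-- The environment is proper with horizon `D`: from every non-absorbing state some
terminating trajectory exists, and every terminating trajectory has length at most `D`. -/
def Proper {S A : Type*} (T : S → A → S) (Abs : Set S) (D : ℕ) : Prop :=
  1 ≤ D ∧ (∀ s ∉ Abs, ∃ as : List A, Terminating T Abs s as) ∧
    ∀ (s : S) (as : List A), Terminating T Abs s as → as.length ≤ D

/-- `g` is reachable from `s`: some terminating trajectory from `s` has achieved goal `g`. -/
def Reachable {S A : Type*} (T : S → A → S) (Abs : Set S) (s g : S) : Prop :=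
  ∃ as : List A, Terminating T Abs s as ∧ achievedGoal T s as = g

/-- The optimal terminal reward at a goal state `g`: the supremum of `R(g, a, T(g, a))`
over actions `a` whose transition from `g` is terminal. -/
noncomputable def Rterm {S A : Type*} (T : S → A → S) (Abs : Set S) (R : S → A → S → ℝ)
    (g : S) : ℝ :=
  sSup {x | ∃ a : A, T g a ∈ Abs ∧ R g a (T g a) = x}
/-- Achieved-goal equality: for every non-absorbing start state `s` and every terminating
trajectory from `s`, the return under the goal-oriented reward for the trajectory's achieved
goal equals the return under `R`. -/
theorem goal_return_eq_return_of_achievedGoal {S A : Type*} (T : S → A → S) (Abs : Set S)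
    (R : S → A → S → ℝ) (rbMIN : ℝ) :
    ∀ s ∉ Abs, ∀ as : List A, Terminating T Abs s as →
      ret T (Rbar Abs rbMIN R (achievedGoal T s as)) s as = ret T R s as := by
  intro s hs as
  induction as generalizing s with
  | nil => intro h; exact absurd rfl h.1
  | cons a as ih =>
    intro h
    obtain ⟨_, h2, h3⟩ := h
    cases as with
    | nil => simp [ret, Rbar, achievedGoal, stateAt]
    | cons b bs =>
      have hT : T s a ∉ Abs := by
        have := h3 1 (by simp)
        simpa [stateAt] using this
      have hterm : Terminating T Abs (T s a) (b :: bs) := by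
        refine ⟨by simp, by simpa [stateAt] using h2, ?_⟩
        intro i hi
        have := h3 (i + 1) (by simpa using hi)
        simpa [stateAt] using this
      have hg : achievedGoal T s (a :: b :: bs) = achievedGoal T (T s a) (b :: bs) := by
        simp [achievedGoal, stateAt]
      have hi := ih (T s a) hT hterm
      rw [hg]
      have e : ∀ R' : S → A → S → ℝ, ret T R' s (a :: b :: bs)
          = R' s a (T s a) + ret T R' (T s a) (b :: bs) := fun _ => rfl
      rw [e, e, hi]
      simp [Rbar, hT]
end

section
/- Assume the environment is proper with horizon D, that rMIN ≤ R(s, a, T(s, a)) ≤ rMAX for all s ∉ Abs and a ∈ A, and that r̄MIN ≤ rMIN. Then for every s ∉ Abs, every g ∈ S, and every a ∈ A, Q̄*(s, g, a) ≤ Q*(s, a). -/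
open Classical

theorem ret_aux {S A : Type*} (T : S → A → S) (Abs : Set S)
    (R : S → A → S → ℝ) (rMIN rMAX rbMIN : ℝ)
    (hbound : ∀ s ∉ Abs, ∀ a : A, rMIN ≤ R s a (T s a) ∧ R s a (T s a) ≤ rMAX)
    (hrb : rbMIN ≤ rMIN) (g : S) (as : List A) :
    ∀ s, (∀ i < as.length, stateAt T s as i ∉ Abs) →
      ret T (Rbar Abs rbMIN R g) s as ≤ ret T R s as ∧
      ret T R s as ≤ as.length * |rMAX| := by
  induction as with
  | nil => intro s _; simp [ret]
  | cons a as ih =>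
    intro s h
    have h0 : s ∉ Abs := by
      have := h 0 (by simp)
      simpa [stateAt] using this
    obtain ⟨h1, h2⟩ := ih (T s a) (by
      intro i hi
      have := h (i + 1) (by simpa using hi)
      simpa [stateAt] using this)
    obtain ⟨b1, b2⟩ := hbound s h0 a
    have h3 : Rbar Abs rbMIN R g s a (T s a) ≤ R s a (T s a) := by
      unfold Rbar
      split_ifs
      · linarith
      · exact le_rfl
    have h4 := le_abs_self rMAX
    simp only [ret, List.length_cons]
    push_cast
    constructor
    · linarith
    · linarith

/-- In a proper environment with bounded rewards and `r̄MIN ≤ rMIN`, the optimal world value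
is at most the optimal task value: `Q̄*(s, g, a) ≤ Q*(s, a)`. -/
theorem qbar_le_qstar {S A : Type*} (T : S → A → S) (Abs : Set S)
    (R : S → A → S → ℝ) (rMIN rMAX rbMIN : ℝ) (D : ℕ)
    (hProper : Proper T Abs D)
    (hbound : ∀ s ∉ Abs, ∀ a : A, rMIN ≤ R s a (T s a) ∧ R s a (T s a) ≤ rMAX)
    (hrb : rbMIN ≤ rMIN) :
    ∀ s ∉ Abs, ∀ (g : S) (a : A),
      Qbar T Abs rbMIN R s g a ≤ Qstar T Abs R s a := by
  intro s hs g a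
  unfold Qbar Qstar
  have key := fun as => ret_aux T Abs R rMIN rMAX rbMIN hbound hrb g as s
  by_cases hne : ∃ as : List A, Terminating T Abs s as ∧ as.head? = some a
  · obtain ⟨as0, ht0, hh0⟩ := hne
    refine csSup_le ⟨_, as0, ht0, hh0, rfl⟩ ?_
    rintro x ⟨as, ht, hh, rfl⟩
    refine le_trans (key as ht.2.2).1 (le_csSup ?_ ⟨as, ht, hh, rfl⟩)
    refine ⟨D * |rMAX|, ?_⟩
    rintro y ⟨bs, hb, -, rfl⟩
    refine le_trans (key bs hb.2.2).2 ?_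
    have : (bs.length : ℝ) ≤ D := by exact_mod_cast hProper.2.2 s bs hb
    exact mul_le_mul_of_nonneg_right this (abs_nonneg _)
  · have he : ∀ R' : S → A → S → ℝ, {x | ∃ as : List A, Terminating T Abs s as ∧
        as.head? = some a ∧ ret T R' s as = x} = ∅ := by
      intro R'
      ext x
      simp only [Set.mem_ofPred_eq, Set.mem_empty_iff_false, iff_false]
      rintro ⟨as, h1, h2, -⟩
      exact hne ⟨as, h1, h2⟩
    rw [he, he]
end

section
/- Assume the environment is proper with horizon D, that rMIN ≤ R(s, a, T(s, a)) ≤ rMAX for all s ∉ Abs and a ∈ A, and that r̄MIN ≤ rMIN. Then for every s ∉ Abs and every a ∈ A, Q*(s, a) equals the supremum over g ∈ G of Q̄*(s, g, a). -/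
open Classical

theorem term_cons {S A : Type*} (T : S → A → S) (Abs : Set S) (s : S) (a : A) (as : List A) :
    Terminating T Abs s (a :: as) ↔
      s ∉ Abs ∧ ((as = [] ∧ T s a ∈ Abs) ∨ Terminating T Abs (T s a) as) := by
  unfold Terminating stateAt
  constructor
  · rintro ⟨-, h1, h2⟩
    have h0 := h2 0 (by simp)
    refine ⟨by simpa using h0, ?_⟩
    rcases as with _ | ⟨b, bs⟩
    · left
      simpa using h1
    · right
      refine ⟨by simp, by simpa using h1, ?_⟩
      intro i hi
      have := h2 (i + 1) (by simpa using hi)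
      simpa using this
  · rintro ⟨h0, h | h⟩
    · obtain ⟨rfl, h⟩ := h
      refine ⟨by simp, by simpa using h, ?_⟩
      intro i hi
      have : i = 0 := by simpa using hi
      subst this
      simpa using h0
    · obtain ⟨-, h1, h2⟩ := h
      refine ⟨by simp, by simpa using h1, ?_⟩
      intro i hi
      rcases i with _ | i
      · simpa using h0
      · have := h2 i (by simpa using hi)
        simpa using this

theorem not_term_nil {S A : Type*} (T : S → A → S) (Abs : Set S) (s : S) :
    ¬ Terminating T Abs s ([] : List A) := fun h => h.1 rfl

theorem term_start {S A : Type*} {T : S → A → S} {Abs : Set S} {s : S} {as : List A}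
    (h : Terminating T Abs s as) : s ∉ Abs := by
  rcases as with _ | ⟨b, bs⟩
  · exact absurd h (not_term_nil T Abs s)
  · exact ((term_cons T Abs s b bs).1 h).1

theorem ret_le {S A : Type*} (T : S → A → S) (Abs : Set S) (R : S → A → S → ℝ) (M : ℝ)
    (hb : ∀ s ∉ Abs, ∀ a : A, R s a (T s a) ≤ M) (as : List A) :
    ∀ s, Terminating T Abs s as → ret T R s as ≤ as.length * M := by
  induction as with
  | nil => intro s h; exact absurd h (not_term_nil T Abs s)
  | cons a as ih =>
    intro s h
    obtain ⟨h0, h | h⟩ := (term_cons T Abs s a as).1 h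
    · obtain ⟨rfl, -⟩ := h
      simpa [ret] using hb s h0 a
    · have h1 := ih _ h
      have h2 := hb s h0 a
      simp only [ret, List.length_cons, Nat.cast_add, Nat.cast_one]
      linarith

theorem ret_bar_le {S A : Type*} (T : S → A → S) (Abs : Set S) (R : S → A → S → ℝ) (m : ℝ)
    (hb : ∀ s ∉ Abs, ∀ a : A, m ≤ R s a (T s a)) (g : S) (as : List A) :
    ∀ s, Terminating T Abs s as → ret T (Rbar Abs m R g) s as ≤ ret T R s as := by
  have key : ∀ s ∉ Abs, ∀ a : A, Rbar Abs m R g s a (T s a) ≤ R s a (T s a) := by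
    intro s hs a
    unfold Rbar
    split_ifs
    · exact hb s hs a
    · exact le_rfl
  induction as with
  | nil => intro s h; exact absurd h (not_term_nil T Abs s)
  | cons a as ih =>
    intro s h
    obtain ⟨h0, h | h⟩ := (term_cons T Abs s a as).1 h
    · obtain ⟨rfl, -⟩ := h
      simpa [ret] using key s h0 a
    · exact add_le_add (key s h0 a) (ih _ h)

theorem exists_goal {S A : Type*} (T : S → A → S) (Abs : Set S) (R : S → A → S → ℝ) (m : ℝ)
    (as : List A) : ∀ s, Terminating T Abs s as →
      ∃ g ∈ goalSet T Abs, ret T (Rbar Abs m R g) s as = ret T R s as := by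
  induction as with
  | nil => intro s h; exact absurd h (not_term_nil T Abs s)
  | cons a as ih =>
    intro s h
    obtain ⟨h0, h | h⟩ := (term_cons T Abs s a as).1 h
    · obtain ⟨rfl, hT⟩ := h
      exact ⟨s, ⟨a, hT⟩, by simp [ret, Rbar]⟩
    · obtain ⟨g, hg, e⟩ := ih _ h
      refine ⟨g, hg, ?_⟩
      have h1 := term_start h
      simp only [ret, e]
      simp [Rbar, h1]

/-- **Theorem 1(ii)**: in a proper environment with bounded rewards and `r̄MIN ≤ rMIN`, the
optimal task value is recovered from the world value function by maximising over goals: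
`Q*(s, a) = sup_{g ∈ G} Q̄*(s, g, a)`. -/
theorem qstar_eq_sup_qbar {S A : Type*} (T : S → A → S) (Abs : Set S)
    (R : S → A → S → ℝ) (rMIN rMAX rbMIN : ℝ) (D : ℕ)
    (hProper : Proper T Abs D)
    (hbound : ∀ s ∉ Abs, ∀ a : A, rMIN ≤ R s a (T s a) ∧ R s a (T s a) ≤ rMAX)
    (hrb : rbMIN ≤ rMIN) :
    ∀ s ∉ Abs, ∀ a : A,
      Qstar T Abs R s a =
        sSup {x | ∃ g ∈ goalSet T Abs, Qbar T Abs rbMIN R s g a = x} := by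
  intro s hs a
  obtain ⟨-, hex, hlen⟩ := hProper
  have hlow : ∀ s ∉ Abs, ∀ a : A, rbMIN ≤ R s a (T s a) :=
    fun s hs a => hrb.trans (hbound s hs a).1
  have hne : ∃ as : List A, Terminating T Abs s as ∧ as.head? = some a := by
    by_cases h : T s a ∈ Abs
    · exact ⟨[a], (term_cons T Abs s a []).2 ⟨hs, Or.inl ⟨rfl, h⟩⟩, rfl⟩
    · obtain ⟨as, has⟩ := hex _ h
      exact ⟨a :: as, (term_cons T Abs s a as).2 ⟨hs, Or.inr has⟩, rfl⟩
  have hB : ∀ as : List A, Terminating T Abs s as → ret T R s as ≤ D * |rMAX| := by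
    intro as has
    have h1 := ret_le T Abs R |rMAX|
      (fun s hs a => (hbound s hs a).2.trans (le_abs_self _)) as s has
    have h2 : (as.length : ℝ) ≤ D := by exact_mod_cast hlen s as has
    exact h1.trans (mul_le_mul_of_nonneg_right h2 (abs_nonneg _))
  have hle : ∀ g, Qbar T Abs rbMIN R s g a ≤ Qstar T Abs R s a := by
    intro g
    unfold Qbar
    conv_lhs => unfold Qstar
    apply csSup_le
    · obtain ⟨as, h1, h2⟩ := hne
      exact ⟨_, as, h1, h2, rfl⟩
    · rintro x ⟨as, h1, h2, rfl⟩
      refine (ret_bar_le T Abs R rbMIN hlow g as s h1).trans ?_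
      apply le_csSup
      · refine ⟨D * |rMAX|, ?_⟩
        rintro x ⟨as, h1, -, rfl⟩
        exact hB as h1
      · exact ⟨as, h1, h2, rfl⟩
  apply le_antisymm
  · conv_lhs => unfold Qstar
    apply csSup_le
    · obtain ⟨as, h1, h2⟩ := hne
      exact ⟨_, as, h1, h2, rfl⟩
    · rintro x ⟨as, h1, h2, rfl⟩
      obtain ⟨g, hg, e⟩ := exists_goal T Abs R rbMIN as s h1
      have h3 : ret T R s as ≤ Qbar T Abs rbMIN R s g a := by
        rw [← e]
        apply le_csSup
        · refine ⟨D * |rMAX|, ?_⟩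
          rintro x ⟨as, h1, -, rfl⟩
          exact (ret_bar_le T Abs R rbMIN hlow g as s h1).trans (hB as h1)
        · exact ⟨as, h1, h2, rfl⟩
      refine h3.trans (le_csSup ⟨Qstar T Abs R s a, ?_⟩ ⟨g, hg, rfl⟩)
      rintro x ⟨g, -, rfl⟩
      exact hle g
  · apply csSup_le
    · obtain ⟨as, h1, -⟩ := hne
      obtain ⟨g, hg, -⟩ := exists_goal T Abs R rbMIN as s h1
      exact ⟨_, g, hg, rfl⟩
    · rintro x ⟨g, -, rfl⟩
      exact hle g
end

section
/- Assume the mastery hypotheses. Let s ∉ Abs and g ∈ S, and let τ₁ and τ₂ be terminating trajectories from s whose achieved goals are g′ and g respectively, with g′ ≠ g. Then the return of τ₁ under R̄(·, g, ·, ·) is at most rMIN·D − rMAX, the return of τ₂ under R̄(·, g, ·, ·) is at least rMIN·D, and in particular the return of τ₁ under R̄(·, g, ·, ·) is strictly less than the return of τ₂ under R̄(·, g, ·, ·). -/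
open Classical

theorem terminating_cons_cons {S A : Type*} {T : S → A → S} {Abs : Set S} {s : S} {a b : A}
    {as : List A} (h : Terminating T Abs s (a :: b :: as)) :
    s ∉ Abs ∧ T s a ∉ Abs ∧ Terminating T Abs (T s a) (b :: as) := by
  obtain ⟨-, h1, h2⟩ := h
  refine ⟨by simpa [stateAt] using h2 0 (by simp), by simpa [stateAt] using h2 1 (by simp),
    by simp, by simpa [stateAt] using h1, fun i hi => ?_⟩
  simpa [stateAt] using h2 (i + 1) (by simpa using hi)

theorem terminating_single {S A : Type*} {T : S → A → S} {Abs : Set S} {s : S} {a : A}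
    (h : Terminating T Abs s [a]) : s ∉ Abs ∧ T s a ∈ Abs := by
  obtain ⟨-, h1, h2⟩ := h
  exact ⟨by simpa [stateAt] using h2 0 (by simp), by simpa [stateAt] using h1⟩

theorem achievedGoal_cons_cons {S A : Type*} (T : S → A → S) (s : S) (a b : A) (as : List A) :
    achievedGoal T s (a :: b :: as) = achievedGoal T (T s a) (b :: as) := by
  simp [achievedGoal, stateAt]

theorem ret_wrong_le {S A : Type*} {T : S → A → S} {Abs : Set S}
    {R : S → A → S → ℝ} {rMIN rMAX : ℝ} (rbMIN : ℝ)
    (hbound : ∀ s ∉ Abs, ∀ a : A, rMIN ≤ R s a (T s a) ∧ R s a (T s a) < rMAX) (g : S)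
    (as : List A) : ∀ s, Terminating T Abs s as → achievedGoal T s as ≠ g →
      ret T (Rbar Abs rbMIN R g) s as ≤ ((as.length : ℝ) - 1) * rMAX + rbMIN := by
  induction as with
  | nil => intro s h; exact absurd rfl h.1
  | cons a as ih =>
    intro s h hg
    cases as with
    | nil =>
      have h1 := terminating_single h
      have hg' : s ≠ g := by simpa [achievedGoal, stateAt] using hg
      simp [ret, Rbar, hg', h1.2]
    | cons b as =>
      obtain ⟨h1, h2, h3⟩ := terminating_cons_cons h
      rw [achievedGoal_cons_cons] at hg
      have h4 := ih _ h3 hg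
      have h5 := (hbound s h1 a).2
      have h6 : Rbar Abs rbMIN R g s a (T s a) = R s a (T s a) := by simp [Rbar, h2]
      rw [ret, h6]
      rw [List.length_cons (a := a)]
      push_cast at h4 ⊢
      linarith

theorem le_ret_correct {S A : Type*} {T : S → A → S} {Abs : Set S}
    {R : S → A → S → ℝ} {rMIN rMAX : ℝ} (rbMIN : ℝ)
    (hbound : ∀ s ∉ Abs, ∀ a : A, rMIN ≤ R s a (T s a) ∧ R s a (T s a) < rMAX) (g : S)
    (as : List A) : ∀ s, Terminating T Abs s as → achievedGoal T s as = g →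
      (as.length : ℝ) * rMIN ≤ ret T (Rbar Abs rbMIN R g) s as := by
  induction as with
  | nil => intro s h; exact absurd rfl h.1
  | cons a as ih =>
    intro s h hg
    cases as with
    | nil =>
      have h1 := terminating_single h
      have hg' : s = g := by simpa [achievedGoal, stateAt] using hg
      have h5 := (hbound s h1.1 a).1
      subst hg'
      simpa [ret, Rbar] using h5
    | cons b as =>
      obtain ⟨h1, h2, h3⟩ := terminating_cons_cons h
      rw [achievedGoal_cons_cons] at hg
      have h4 := ih _ h3 hg
      have h5 := (hbound s h1 a).1
      have h6 : Rbar Abs rbMIN R g s a (T s a) = R s a (T s a) := by simp [Rbar, h2]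
      rw [ret, h6]
      rw [List.length_cons (a := a)]
      push_cast at h4 ⊢
      linarith

/-- Strict separation of wrong-goal returns from correct-goal returns (core of the proof of
**Theorem 2**): under the mastery hypotheses, a terminating trajectory achieving a wrong goal
has `R̄`-return at most `rMIN·D − rMAX`, one achieving the goal `g` has `R̄`-return at least
`rMIN·D`, and the former is strictly less than the latter. -/
theorem wrong_goal_return_lt_correct_goal_return {S A : Type*} (T : S → A → S) (Abs : Set S)
    (R : S → A → S → ℝ) (rMIN rMAX rbMIN : ℝ) (D : ℕ)
    (hProper : Proper T Abs D)
    (hbound : ∀ s ∉ Abs, ∀ a : A, rMIN ≤ R s a (T s a) ∧ R s a (T s a) < rMAX)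
    (hrMIN : rMIN ≤ 0) (hrMAX : 0 < rMAX)
    (hrb : rbMIN = (rMIN - rMAX) * D) :
    ∀ s ∉ Abs, ∀ (g : S) (as₁ as₂ : List A),
      Terminating T Abs s as₁ → Terminating T Abs s as₂ →
      achievedGoal T s as₁ ≠ g → achievedGoal T s as₂ = g →
      ret T (Rbar Abs rbMIN R g) s as₁ ≤ rMIN * D - rMAX ∧
      rMIN * D ≤ ret T (Rbar Abs rbMIN R g) s as₂ ∧
      ret T (Rbar Abs rbMIN R g) s as₁ < ret T (Rbar Abs rbMIN R g) s as₂ := by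
  intro s hs g as₁ as₂ h1 h2 hg1 hg2
  have e1 := ret_wrong_le rbMIN hbound g as₁ s h1 hg1
  have e2 := le_ret_correct rbMIN hbound g as₂ s h2 hg2
  have l1 : (as₁.length : ℝ) ≤ D := by exact_mod_cast hProper.2.2 s as₁ h1
  have l2 : (as₂.length : ℝ) ≤ D := by exact_mod_cast hProper.2.2 s as₂ h2
  have m1 := mul_le_mul_of_nonneg_right l1 hrMAX.le
  have m2 := mul_le_mul_of_nonpos_right l2 hrMIN
  have f1 : ret T (Rbar Abs rbMIN R g) s as₁ ≤ rMIN * D - rMAX := by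
    rw [hrb] at e1 ⊢
    linarith
  have f2 : rMIN * D ≤ ret T (Rbar Abs rbMIN R g) s as₂ := by linarith
  exact ⟨f1, f2, by linarith⟩
end

section
/- Let R₁ and R₂ be two reward functions on the same environment that agree on non-terminal transitions, each satisfying the mastery hypotheses with the same rMIN, rMAX, D and r̄MIN. If s ∉ Abs and g ∈ S is not reachable from s, then Q̄*₁(s, g, a) = Q̄*₂(s, g, a) for every a ∈ A. -/
open Classical

/-- Along a terminating trajectory whose achieved goal is not `g`, the goal-oriented returns of
two rewards that agree on non-terminal transitions coincide. -/
theorem ret_Rbar_eq_of_ne {S A : Type*} (T : S → A → S) (Abs : Set S)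
    (R₁ R₂ : S → A → S → ℝ) (rbMIN : ℝ) (g : S)
    (hagree : ∀ (s : S) (a : A), T s a ∉ Abs → R₁ s a (T s a) = R₂ s a (T s a)) :
    ∀ (as : List A) (s : S), Terminating T Abs s as → achievedGoal T s as ≠ g →
      ret T (Rbar Abs rbMIN R₁ g) s as = ret T (Rbar Abs rbMIN R₂ g) s as := by
  intro as
  induction as with
  | nil => intro s h _; exact absurd rfl h.1
  | cons a as ih =>
    intro s h hg
    obtain ⟨-, hend, hnot⟩ := h
    cases as with
    | nil =>
      have h1 : T s a ∈ Abs := by simpa [stateAt] using hend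
      have h2 : s ≠ g := by simpa [achievedGoal, stateAt] using hg
      simp [ret, Rbar, h1, h2]
    | cons b bs =>
      have h1 : T s a ∉ Abs := by
        have := hnot 1 (by simp)
        simpa [stateAt] using this
      have hT : Terminating T Abs (T s a) (b :: bs) := by
        refine ⟨by simp, by simpa [stateAt] using hend, ?_⟩
        intro i hi
        have := hnot (i + 1) (by simpa using hi)
        simpa [stateAt] using this
      have hg' : achievedGoal T (T s a) (b :: bs) ≠ g := by
        simpa [achievedGoal, stateAt] using hg
      have hrec := ih (T s a) hT hg'
      rw [ret, ret.eq_2 T (Rbar Abs rbMIN R₂ g), hrec]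
      simp [Rbar, h1, hagree s a h1]

/-- Unreachable-goal case in the proof of **Theorem 3**: if two reward functions agree on
non-terminal transitions and both satisfy the mastery hypotheses, then their optimal world
values agree on goals that are unreachable from `s`. -/
theorem qbar_eq_of_unreachable {S A : Type*} (T : S → A → S) (Abs : Set S)
    (R₁ R₂ : S → A → S → ℝ) (rMIN rMAX rbMIN : ℝ) (D : ℕ)
    (hProper : Proper T Abs D)
    (hagree : ∀ (s : S) (a : A), T s a ∉ Abs → R₁ s a (T s a) = R₂ s a (T s a))
    (hbound₁ : ∀ s ∉ Abs, ∀ a : A, rMIN ≤ R₁ s a (T s a) ∧ R₁ s a (T s a) < rMAX)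
    (hbound₂ : ∀ s ∉ Abs, ∀ a : A, rMIN ≤ R₂ s a (T s a) ∧ R₂ s a (T s a) < rMAX)
    (hrMIN : rMIN ≤ 0) (hrMAX : 0 < rMAX)
    (hrb : rbMIN = (rMIN - rMAX) * D) :
    ∀ s ∉ Abs, ∀ g : S, ¬ Reachable T Abs s g →
      ∀ a : A, Qbar T Abs rbMIN R₁ s g a = Qbar T Abs rbMIN R₂ s g a := by
  intro s _ g hg a
  unfold Qbar Qstar
  congr 1
  ext x
  have key : ∀ as : List A, Terminating T Abs s as →
      ret T (Rbar Abs rbMIN R₁ g) s as = ret T (Rbar Abs rbMIN R₂ g) s as := fun as h =>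
    ret_Rbar_eq_of_ne T Abs R₁ R₂ rbMIN g hagree as s h (fun e => hg ⟨as, h, e⟩)
  constructor
  · rintro ⟨as, h, hh, hx⟩
    exact ⟨as, h, hh, (key as h).symm.trans hx⟩
  · rintro ⟨as, h, hh, hx⟩
    exact ⟨as, h, hh, (key as h).trans hx⟩
end

section
/- Assume the mastery hypotheses. Let s ∉ Abs, g ∈ S with s ≠ g, and a ∈ A, and suppose there exists a terminating trajectory from s with first action a and achieved goal g. Then Q̄*(s, g, a) = P*(s, g, a) + Rterm(g), where P*(s, g, a) is the supremum, over terminating trajectories from s with first action a and achieved goal g, of the return with the final reward omitted (i.e. ∑_{i<n−1} R(s_i, a_i, s_{i+1})), and Rterm(g) is the supremum over {a′ ∈ A : T(g, a′) ∈ Abs} of R(g, a′, T(g, a′)). -/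
open Classical

theorem aux_term {S A : Type*} {T : S → A → S} {Abs : Set S} {s : S} {l : List A} {b : A} :
    Terminating T Abs s (l ++ [b]) ↔
      T (l.foldl T s) b ∈ Abs ∧ ∀ i ≤ l.length, (l.take i).foldl T s ∉ Abs := by
  unfold Terminating stateAt
  constructor
  · rintro ⟨-, h1, h2⟩
    rw [List.take_length, List.foldl_append] at h1
    refine ⟨h1, fun i hi => ?_⟩
    have := h2 i (by simp; omega)
    rwa [List.take_append_of_le_length hi] at this
  · rintro ⟨h1, h2⟩
    refine ⟨by simp, by rw [List.take_length, List.foldl_append]; exact h1, fun i hi => ?_⟩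
    have hi' : i ≤ l.length := by simp at hi; omega
    rw [List.take_append_of_le_length hi']
    exact h2 i hi'

theorem aux_goal {S A : Type*} {T : S → A → S} {s : S} {l : List A} {b : A} :
    achievedGoal T s (l ++ [b]) = l.foldl T s := by
  simp [achievedGoal, stateAt]

theorem aux_ret {S A : Type*} {T : S → A → S} {R : S → A → S → ℝ} {s : S} {l : List A} {b : A} :
    ret T R s (l ++ [b]) = ret T R s l + R (l.foldl T s) b (T (l.foldl T s) b) := by
  induction l generalizing s with
  | nil => simp [ret]
  | cons c l ih => simp [ret, ih, add_assoc]

theorem aux_bar {S A : Type*} {T : S → A → S} {Abs : Set S} {R : S → A → S → ℝ} {m : ℝ} {g : S}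
    {s : S} {l : List A} (h : ∀ i ≤ l.length, (l.take i).foldl T s ∉ Abs) :
    ret T (Rbar Abs m R g) s l = ret T R s l := by
  induction l generalizing s with
  | nil => simp [ret]
  | cons c l ih =>
    have h1 := h 1 (by simp)
    have h2 := ih (s := T s c) (fun i hi => by simpa using h (i + 1) (by simpa using hi))
    have h3 : T s c ∉ Abs := by simpa using h1
    simp [ret, h2, Rbar, h3]

theorem aux_bounds {S A : Type*} {T : S → A → S} {Abs : Set S} {R : S → A → S → ℝ} {m M : ℝ}
    (hb : ∀ s ∉ Abs, ∀ a : A, m ≤ R s a (T s a) ∧ R s a (T s a) < M)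
    {s : S} {l : List A} (h : ∀ i ≤ l.length, (l.take i).foldl T s ∉ Abs) :
    l.length * m ≤ ret T R s l ∧ ret T R s l ≤ l.length * M := by
  induction l generalizing s with
  | nil => simp [ret]
  | cons c l ih =>
    have h0 : s ∉ Abs := by simpa using h 0 (by simp)
    have h2 := ih (s := T s c) (fun i hi => by simpa using h (i + 1) (by simpa using hi))
    have h3 := hb s h0 c
    simp only [ret, List.length_cons]
    push_cast
    constructor <;> linarith [h2.1, h2.2, h3.1, h3.2]

theorem aux_split {A : Type*} {as : List A} {a : A} (h : as.head? = some a) :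
    ∃ l b, as = l ++ [b] := by
  have hne : as ≠ [] := by rintro rfl; simp at h
  exact ⟨as.dropLast, as.getLast hne, (List.dropLast_append_getLast hne).symm⟩

/-- Decomposition `Q̄*(s, g, a) = G*_{s,g,a} + Rterm(g)` used to derive Theorems 3 and 4:
under the mastery hypotheses, if some terminating trajectory from `s ≠ g` has first action `a`
and achieved goal `g`, then `Q̄*(s, g, a)` equals the supremum of final-reward-omitted returns
over such trajectories, plus the optimal terminal reward at `g`. -/
theorem qbar_decomposition {S A : Type*} (T : S → A → S) (Abs : Set S)
    (R : S → A → S → ℝ) (rMIN rMAX rbMIN : ℝ) (D : ℕ)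
    (hProper : Proper T Abs D)
    (hbound : ∀ s ∉ Abs, ∀ a : A, rMIN ≤ R s a (T s a) ∧ R s a (T s a) < rMAX)
    (hrMIN : rMIN ≤ 0) (hrMAX : 0 < rMAX)
    (hrb : rbMIN = (rMIN - rMAX) * D) :
    ∀ s ∉ Abs, ∀ g : S, s ≠ g → ∀ a : A,
      (∃ as : List A, Terminating T Abs s as ∧ as.head? = some a ∧
        achievedGoal T s as = g) →
      Qbar T Abs rbMIN R s g a =
        sSup {x | ∃ as : List A, Terminating T Abs s as ∧ as.head? = some a ∧
            achievedGoal T s as = g ∧ ret T R s as.dropLast = x} +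
          Rterm T Abs R g := by
  intro s hs g hsg a hex
  obtain ⟨hD1, -, hD⟩ := hProper
  have hDR : (1 : ℝ) ≤ D := by exact_mod_cast hD1
  unfold Qbar Qstar Rterm
  set X : Set ℝ := {x | ∃ as : List A, Terminating T Abs s as ∧ as.head? = some a ∧
            achievedGoal T s as = g ∧ ret T R s as.dropLast = x} with hX
  set Y : Set ℝ := {x | ∃ a : A, T g a ∈ Abs ∧ R g a (T g a) = x} with hY
  obtain ⟨as₀, ht₀, hh₀, hg₀⟩ := hex
  obtain ⟨l₀, b₀, rfl⟩ := aux_split hh₀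
  have hlen₀ := hD _ _ ht₀
  have ht₀' := aux_term.1 ht₀
  have hg₀' := hg₀
  rw [aux_goal] at hg₀'
  have hgA : g ∉ Abs := by
    have := ht₀'.2 l₀.length le_rfl
    rwa [List.take_length, hg₀'] at this
  have hYb : BddAbove Y := ⟨rMAX, by rintro x ⟨c, -, rfl⟩; exact (hbound g hgA c).2.le⟩
  have hXb : BddAbove X := by
    refine ⟨D * rMAX, ?_⟩
    rintro x ⟨as, ht, hh, -, rfl⟩
    obtain ⟨l, b, rfl⟩ := aux_split hh
    have h1 := aux_bounds hbound (aux_term.1 ht).2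
    have h2 : (l.length : ℝ) ≤ D := by
      have := hD _ _ ht
      simp at this
      exact_mod_cast (by omega : l.length ≤ D)
    simp only [List.dropLast_concat]
    nlinarith [h1.2]
  have hx₀ : ret T R s l₀ ∈ X := ⟨_, ht₀, hh₀, hg₀, by simp⟩
  have hy₀ : R g b₀ (T g b₀) ∈ Y := ⟨b₀, by rw [← hg₀']; exact ht₀'.1, rfl⟩
  have hlow : D * rMIN ≤ sSup X + sSup Y := by
    have h1 := le_csSup hXb hx₀
    have h2 := le_csSup hYb hy₀
    have h3 := (aux_bounds hbound ht₀'.2).1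
    have h4 := (hbound g hgA b₀).1
    have h5 : (l₀.length : ℝ) + 1 ≤ D := by
      simp at hlen₀
      exact_mod_cast hlen₀
    nlinarith
  have hup : ∀ x ∈ {x | ∃ as : List A, Terminating T Abs s as ∧ as.head? = some a ∧
      ret T (Rbar Abs rbMIN R g) s as = x}, x ≤ sSup X + sSup Y := by
    rintro x ⟨as, ht, hh, rfl⟩
    obtain ⟨l, b, rfl⟩ := aux_split hh
    have ht' := aux_term.1 ht
    rw [aux_ret, aux_bar ht'.2]
    by_cases hg : l.foldl T s = g
    · have h1 : ret T R s l ∈ X := ⟨_, ht, hh, by rw [aux_goal, hg], by simp⟩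
      have h2 : R g b (T g b) ∈ Y := ⟨b, by rw [← hg]; exact ht'.1, rfl⟩
      have h3 : Rbar Abs rbMIN R g (l.foldl T s) b (T (l.foldl T s) b) = R g b (T g b) := by
        simp [Rbar, hg]
      rw [h3]
      exact add_le_add (le_csSup hXb h1) (le_csSup hYb h2)
    · have h3 : Rbar Abs rbMIN R g (l.foldl T s) b (T (l.foldl T s) b) = rbMIN := by
        simp [Rbar, hg, ht'.1]
      rw [h3, hrb]
      have h1 := (aux_bounds hbound ht'.2).2
      have h5 : (l.length : ℝ) + 1 ≤ D := by
        have := hD _ _ ht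
        simp at this
        exact_mod_cast this
      nlinarith
  apply le_antisymm
  · exact csSup_le ⟨_, _, ht₀, hh₀, rfl⟩ hup
  · rw [← le_sub_iff_add_le]
    refine csSup_le ⟨_, hx₀⟩ ?_
    rintro x ⟨as, ht, hh, hg, rfl⟩
    obtain ⟨l, b, rfl⟩ := aux_split hh
    rw [le_sub_comm]
    refine csSup_le ⟨_, hy₀⟩ ?_
    rintro y ⟨c, hc, rfl⟩
    rw [le_sub_iff_add_le']
    rw [aux_goal] at hg
    have ht' := aux_term.1 ht
    refine le_csSup ⟨_, hup⟩ ⟨l ++ [c], aux_term.2 ⟨by rw [hg]; exact hc, ht'.2⟩, ?_, ?_⟩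
    · cases l with
      | nil => exact absurd hg hsg
      | cons d l => simpa using hh
    · rw [aux_ret, aux_bar ht'.2]
      simp [Rbar, hg]
end
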